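/- Let p ∈ (1/2, 1). For every j ∈ ℕ, the kernel q_p satisfies the identity (Σ_{k=0}^{∞} q_p(j,k)·(k − 1)²) − (j − 1)² = j·(6 − 2p/(1 − p)) + (1/(1 − p))·(−5p + 2p²/(1 − p) − 2p^{j+3}/(1 − p) + 2 + p^{j+1}), where the series on the left converges absolutely. -/

import Mathlib

open MeasureTheory Filter

noncomputable section

/-- The transition kernel of the Markov chain of leftward-jump counts associated with the
random walk in a homogeneous "have your cookie and eat it" environment with parameter `p`. -/
def qp (p : ℝ) (j k : ℕ) : ℝ :=
  if k = 0 then p ^ (j + 1)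
  else (1 - p) * ∑ l ∈ Finset.range (j + 1),
    p ^ l * (Nat.choose (j - l + k - 1) (k - 1) : ℝ) * ((1 : ℝ) / 2) ^ (j - l + k)

/-- `μ` is an invariant probability distribution on `ℕ` for the kernel `qp p`. -/
def IsInvariantFor (p : ℝ) (μ : ℕ → ℝ) : Prop :=
  (∀ k, 0 ≤ μ k) ∧ (∑' k, μ k) = 1 ∧ ∀ k, (∑' j, μ j * qp p j k) = μ k

/-- The second moment of the negative binomial distribution with parameters `m + 1` and `1 / 2`. -/
lemma hasSum_choose_mul_half_pow_mul_sq (m : ℕ) :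
    HasSum (fun n : ℕ => ((m + n).choose n : ℝ) * (1 / 2) ^ (m + n + 1) * (n : ℝ) ^ 2)
      (((m : ℝ) + 1) * (m + 3)) := by
  have half_lt : ‖(1 / 2 : ℝ)‖ < 1 := by norm_num
  have h0 := hasSum_choose_mul_geometric_of_norm_lt_one m half_lt
  have h1 := hasSum_choose_mul_geometric_of_norm_lt_one (m + 1) half_lt
  have h2 := hasSum_choose_mul_geometric_of_norm_lt_one (m + 2) half_lt
  have h := (((h2.mul_left (((m : ℝ) + 1) * (m + 2))).sub
    (h1.mul_left ((2 * (m : ℝ) + 3) * (m + 1)))).add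
    (h0.mul_left (((m : ℝ) + 1) ^ 2))).mul_right ((1 / 2 : ℝ) ^ (m + 1))
  convert! h using 1
  · funext n
    have e0 : ((m + n).choose n : ℝ) = ((n + m).choose m : ℝ) := by
      rw [add_comm n m, Nat.choose_symm_add]
    have e1 : ((n : ℝ) + m + 1) * ((n + m).choose m : ℝ)
        = ((n + (m + 1)).choose (m + 1) : ℝ) * (m + 1) := by
      exact_mod_cast Nat.add_one_mul_choose_eq (n + m) m
    have e2 : ((n : ℝ) + (m + 1) + 1) * ((n + (m + 1)).choose (m + 1) : ℝ)
        = ((n + (m + 2)).choose (m + 2) : ℝ) * (m + 1 + 1) := by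
      exact_mod_cast Nat.add_one_mul_choose_eq (n + (m + 1)) (m + 1)
    rw [e0]
    linear_combination (1 / 2 : ℝ) ^ (m + n + 1) *
      (((n : ℝ) + m + 2 - (2 * m + 3)) * e1 + ((m : ℝ) + 1) * e2)
  · have e : (1 - 1 / 2 : ℝ) = 1 / 2 := by norm_num
    rw [e]
    have : (1 / 2 : ℝ) ^ m ≠ 0 := by positivity
    simp only [pow_succ]
    field_simp
    ring

/-- The second moment of row `j` of `qp p` around `1`, as a finite sum. -/
lemma hasSum_qp_mul_sq (p : ℝ) (j : ℕ) :
    HasSum (fun k : ℕ => qp p j k * ((k : ℝ) - 1) ^ 2)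
      (p ^ (j + 1) + (1 - p) * ∑ l ∈ Finset.range (j + 1),
        p ^ l * (((j - l : ℕ) + 1 : ℝ) * ((j - l : ℕ) + 3))) := by
  rw [← hasSum_nat_add_iff' 1]
  have h := (hasSum_sum (s := Finset.range (j + 1)) fun l _ =>
    (hasSum_choose_mul_half_pow_mul_sq (j - l)).mul_left (p ^ l)).mul_left (1 - p)
  convert! h using 1
  · funext k
    simp only [qp, Nat.succ_ne_zero, if_false, Nat.add_sub_cancel, ← add_assoc]
    rw [mul_assoc, Finset.sum_mul]
    congr 1
    refine Finset.sum_congr rfl fun l _ => ?_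
    push_cast
    ring
  · simp [qp]

lemma sum_range_pow_mul_closed_form {p : ℝ} (hp : 1 - p ≠ 0) (j : ℕ) :
    p ^ (j + 1) + (1 - p) * (∑ l ∈ Finset.range (j + 1),
        p ^ l * (((j - l : ℕ) + 1 : ℝ) * ((j - l : ℕ) + 3))) - ((j : ℝ) - 1) ^ 2 =
      (j : ℝ) * (6 - 2 * p / (1 - p)) +
        (1 / (1 - p)) * (-5 * p + 2 * p ^ 2 / (1 - p) - 2 * p ^ (j + 3) / (1 - p)
          + 2 + p ^ (j + 1)) := by
  induction j with
  | zero =>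
    norm_num
    field_simp
    ring
  | succ j ih =>
    have rec_sum : ∑ l ∈ Finset.range (j + 1 + 1),
          p ^ l * (((j + 1 - l : ℕ) + 1 : ℝ) * ((j + 1 - l : ℕ) + 3)) =
        p * ∑ l ∈ Finset.range (j + 1),
          p ^ l * (((j - l : ℕ) + 1 : ℝ) * ((j - l : ℕ) + 3)) + ((j : ℝ) + 2) * (j + 4) := by
      rw [Finset.sum_range_succ', Finset.mul_sum]
      congr 1
      · refine Finset.sum_congr rfl fun l _ => ?_
        rw [Nat.add_sub_add_right]
        ring
      · push_cast
        ring
    rw [rec_sum]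
    generalize ∑ l ∈ Finset.range (j + 1),
      p ^ l * (((j - l : ℕ) + 1 : ℝ) * ((j - l : ℕ) + 3)) = T at ih
    push_cast
    have key : (1 - p) * T = _ := eq_sub_of_add_eq' (sub_eq_iff_eq_add.mp ih)
    rw [mul_add, mul_left_comm, key]
    field_simp
    ring

/-- Second-moment identity for the kernel `qp p`. -/
theorem stmt16 (p : ℝ) (hp : p ∈ Set.Ioo (1 / 2 : ℝ) 1) :
    ∀ j : ℕ, Summable (fun k : ℕ => |qp p j k * ((k : ℝ) - 1) ^ 2|) ∧
      (∑' k : ℕ, qp p j k * ((k : ℝ) - 1) ^ 2) - ((j : ℝ) - 1) ^ 2 =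
        (j : ℝ) * (6 - 2 * p / (1 - p)) +
          (1 / (1 - p)) * (-5 * p + 2 * p ^ 2 / (1 - p) - 2 * p ^ (j + 3) / (1 - p)
            + 2 + p ^ (j + 1)) := by
  intro j
  have h := hasSum_qp_mul_sq p j
  refine ⟨h.summable.abs, ?_⟩
  rw [h.tsum_eq]
  exact sum_range_pow_mul_closed_form (sub_ne_zero.mpr hp.2.ne') j
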